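/- arXiv:1403.3896 — 2 statements merged into one kernel-verified Lean document; each statement's English description precedes it below -/
import Mathlib

section
/- Let G = Q(2^m) be the generalized quaternion group of order 2^m with m ≥ 4, with generators x, y satisfying y^{2^{m-1}} = 1, x² = y^{2^{m-2}}, x⁻¹yx = y⁻¹. Then the three maximal subgroups are M₁ = ⟨y⟩, M₂ = ⟨x, y²⟩, M₃ = ⟨xy, y²⟩, and the transfer kernels are Ker(V₁) = M₁/[G,G], Ker(V₂) = M₃/[G,G], Ker(V₃) = M₂/[G,G]. In particular, every transfer from G to a maximal subgroup has nontrivial kernel, and no transfer is trivial on all of G/[G,G]. -/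
open MulAction in
/-- The transfer to a subgroup of index two, evaluated outside that subgroup, is squaring. -/
theorem MonoidHom.transfer_eq_sq_of_index_two {G A : Type*} [Group G] [CommGroup A]
    {H : Subgroup G} [H.FiniteIndex] (hH : H.index = 2) (ϕ : H →* A) {g : G} (hg : g ∉ H) :
    MonoidHom.transfer ϕ g = ϕ ⟨g ^ 2, Subgroup.sq_mem_of_index_two hH g⟩ := by
  classical
  let := H.fintypeQuotientOfFiniteIndex
  have hnormal : H.Normal := Subgroup.normal_of_index_eq_two hH
  have horbit : ∀ q : G ⧸ H, q ∈ orbit (Subgroup.zpowers g) ((1 : G) : G ⧸ H) := by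
    intro q
    induction q using QuotientGroup.induction_on with
    | H a =>
      by_cases ha : a ∈ H
      · refine ⟨1, ?_⟩
        rw [QuotientGroup.eq_one_iff a |>.2 ha]
        simp
      · refine ⟨⟨g, Subgroup.mem_zpowers g⟩, ?_⟩
        change ((g * 1 : G) : G ⧸ H) = a
        rw [QuotientGroup.eq, Subgroup.mul_mem_iff_of_index_two hH]
        simp [ha, hg]
  have hsub : Subsingleton (Quotient (orbitRel (Subgroup.zpowers g) (G ⧸ H))) := by
    refine ⟨fun p q => ?_⟩
    induction p using Quotient.inductionOn
    induction q using Quotient.inductionOn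
    refine Quotient.sound ?_
    change _ ∈ orbit _ _
    rw [orbit_eq_iff.2 (horbit _)]
    exact horbit _
  let _ : Unique (Quotient (orbitRel (Subgroup.zpowers g) (G ⧸ H))) :=
    { default := Quotient.mk _ ((1 : G) : G ⧸ H), uniq := fun _ => Subsingleton.elim _ _ }
  have hper := Subgroup.index_eq_sum_minimalPeriod H g
  rw [hH, Fintype.sum_unique] at hper
  rw [MonoidHom.transfer_eq_prod_quotient_orbitRel_zpowers_quot, Fintype.prod_unique]
  set a : G := (default : Quotient (orbitRel (Subgroup.zpowers g) (G ⧸ H))).out.out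
  simp only [← hper]
  by_cases ha : a ∈ H
  · have : (⟨a⁻¹ * g ^ 2 * a, hnormal.conj_mem' _ (Subgroup.sq_mem_of_index_two hH g) a⟩ : H) =
        ⟨a, ha⟩⁻¹ * ⟨g ^ 2, Subgroup.sq_mem_of_index_two hH g⟩ * ⟨a, ha⟩ := rfl
    rw [this, map_mul, map_mul, map_inv, mul_right_comm, inv_mul_cancel, one_mul]
  · have hb : g⁻¹ * a ∈ H := by
      rw [Subgroup.mul_mem_iff_of_index_two hH]
      simp [ha, hg]
    have : (⟨a⁻¹ * g ^ 2 * a, hnormal.conj_mem' _ (Subgroup.sq_mem_of_index_two hH g) a⟩ : H) =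
        ⟨g⁻¹ * a, hb⟩⁻¹ * ⟨g ^ 2, Subgroup.sq_mem_of_index_two hH g⟩ * ⟨g⁻¹ * a, hb⟩ := by
      ext
      simp only [Subgroup.coe_mul, Subgroup.coe_inv]
      group
    rw [this, map_mul, map_mul, map_inv, mul_right_comm, inv_mul_cancel, one_mul]

theorem Subgroup.isCoatom_of_index_eq_two {G : Type*} [Group G] {M : Subgroup G}
    (hM : M.index = 2) : IsCoatom M := by
  refine ⟨fun h => by simp [h] at hM, fun K hK => ?_⟩
  obtain ⟨a, haK, haM⟩ := SetLike.exists_of_lt hK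
  refine (Subgroup.eq_top_iff' K).2 fun b => ?_
  by_cases hb : b ∈ M
  · exact hK.le hb
  · have : b * a ∈ M := by
      rw [Subgroup.mul_mem_iff_of_index_two hM]
      simp [hb, haM]
    exact (Subgroup.mul_mem_cancel_right K haK).1 (hK.le this)

theorem Subgroup.index_eq_two_of_isCoatom {G : Type*} [Group G] [Finite G] {m : ℕ}
    (hG : Nat.card G = 2 ^ m) {M : Subgroup G} (hM : IsCoatom M) : M.index = 2 := by
  obtain ⟨n, hn, hcard⟩ := (Nat.dvd_prime_pow Nat.prime_two).1 (hG ▸ M.card_subgroup_dvd_card)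
  have hnm : n ≠ m := by
    rintro rfl
    exact hM.1 (Subgroup.eq_top_of_card_eq M (hcard.trans hG.symm))
  obtain ⟨K, hK, hMK⟩ := Sylow.exists_subgroup_card_pow_succ (p := 2) (n := n)
    (hG ▸ pow_dvd_pow 2 (by omega)) hcard
  have hlt : M < K := by
    refine lt_of_le_of_ne hMK ?_
    rintro rfl
    rw [hcard, pow_succ] at hK
    have := pow_pos (two_pos (α := ℕ)) n
    omega
  have htop := hM.2 K hlt
  rw [htop, Subgroup.card_top, pow_succ] at hK
  have h := M.card_mul_index
  rw [hcard, hK] at h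
  exact Nat.eq_of_mul_eq_mul_left (pow_pos two_pos n) h

theorem zpow_mul_eq_mul_zpow_neg {G : Type*} [Group G] {x y : G} (h : y * x = x * y⁻¹) (k : ℤ) :
    y ^ k * x = x * y ^ (-k) := by
  have : SemiconjBy x y⁻¹ y := h.symm
  simpa only [inv_zpow'] using (this.zpow_right k).symm

/-- The facts about the standard generators of a generalized quaternion group of order at least
sixteen that are stable under replacing `x` by `x * y`. -/
structure IsQuaternionPair {G : Type*} [Group G] (x y : G) : Prop where
  mul_comm_inv : y * x = x * y⁻¹
  sq_eq : ∃ j : ℤ, x ^ 2 = y ^ (4 * j)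
  sq_ne_one : x ^ 2 ≠ 1
  notMem : x ∉ Subgroup.zpowers y
  four_dvd : ∀ k : ℤ, y ^ k = 1 → 4 ∣ k
  exists_zpow : ∀ g : G, ∃ k : ℤ, g = y ^ k ∨ g = x * y ^ k

namespace IsQuaternionPair

variable {G : Type*} [Group G] {x y : G}

theorem zpow_mul (h : IsQuaternionPair x y) (k : ℤ) : y ^ k * x = x * y ^ (-k) :=
  zpow_mul_eq_mul_zpow_neg h.mul_comm_inv k

theorem mul_zpow_mul (h : IsQuaternionPair x y) (a b : ℤ) :
    (x * y ^ a) * (x * y ^ b) = x ^ 2 * y ^ (b - a) := by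
  rw [mul_assoc, ← mul_assoc (y ^ a), h.zpow_mul, mul_assoc x (y ^ (-a)), ← zpow_add,
    ← mul_assoc, sq, neg_add_eq_sub]

theorem mul_self_mul (h : IsQuaternionPair x y) : (x * y) ^ 2 = x ^ 2 := by
  simpa [sq] using h.mul_zpow_mul 1 1

theorem zpow_ne_zpow (h : IsQuaternionPair x y) {a b : ℤ} (hab : ¬ 4 ∣ a - b) :
    y ^ a ≠ y ^ b := by
  intro heq
  exact hab (h.four_dvd _ (by rw [zpow_sub, heq, mul_inv_cancel]))

theorem mul_zpow_ne_zpow (h : IsQuaternionPair x y) (a b : ℤ) : x * y ^ a ≠ y ^ b := by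
  intro heq
  apply h.notMem
  rw [← mul_inv_eq_iff_eq_mul.2 heq.symm]
  exact mul_mem (zpow_mem (Subgroup.mem_zpowers y) b)
    (inv_mem (zpow_mem (Subgroup.mem_zpowers y) a))

theorem mul_right (h : IsQuaternionPair x y) : IsQuaternionPair (x * y) y where
  mul_comm_inv := by rw [← mul_assoc, h.mul_comm_inv, mul_assoc, mul_assoc, inv_mul_cancel,
    mul_inv_cancel]
  sq_eq := h.mul_self_mul ▸ h.sq_eq
  sq_ne_one := h.mul_self_mul ▸ h.sq_ne_one
  notMem := by
    rintro ⟨k, hk⟩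
    exact h.mul_zpow_ne_zpow 1 k (by simpa using hk.symm)
  four_dvd := h.four_dvd
  exists_zpow g := by
    obtain ⟨k, rfl | rfl⟩ := h.exists_zpow g
    · exact ⟨k, Or.inl rfl⟩
    · exact ⟨k - 1, Or.inr (by rw [mul_assoc, ← zpow_one_add]; congr 2; ring)⟩

theorem mem_closure_iff (h : IsQuaternionPair x y) {g : G} :
    g ∈ Subgroup.closure {x, y ^ 2} ↔ ∃ k : ℤ, g = y ^ (2 * k) ∨ g = x * y ^ (2 * k) := by
  have hx : x ∈ Subgroup.closure {x, y ^ 2} := Subgroup.subset_closure (by simp)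
  have hy (k : ℤ) : y ^ (2 * k) ∈ Subgroup.closure {x, y ^ 2} := by
    rw [_root_.zpow_mul]
    exact zpow_mem (Subgroup.subset_closure (by simp)) k
  obtain ⟨j, hj⟩ := h.sq_eq
  constructor
  · intro hg
    induction hg using Subgroup.closure_induction with
    | mem g hg =>
      obtain rfl | rfl := hg
      · exact ⟨0, Or.inr (by simp)⟩
      · exact ⟨1, Or.inl (by simp)⟩
    | one => exact ⟨0, Or.inl (by simp)⟩
    | mul a b _ _ ha hb =>
      obtain ⟨k, rfl | rfl⟩ := ha <;> obtain ⟨l, rfl | rfl⟩ := hb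
      · exact ⟨k + l, Or.inl (by rw [← zpow_add]; congr 1; ring)⟩
      · exact ⟨l - k, Or.inr (by
          rw [← mul_assoc, h.zpow_mul, mul_assoc, ← zpow_add]; congr 2; ring)⟩
      · exact ⟨k + l, Or.inr (by rw [mul_assoc, ← zpow_add]; congr 2; ring)⟩
      · exact ⟨2 * j + l - k, Or.inl (by
          rw [h.mul_zpow_mul, hj, ← zpow_add]; congr 1; ring)⟩
    | inv a _ ha =>
      obtain ⟨k, rfl | rfl⟩ := ha
      · exact ⟨-k, Or.inl (by rw [← zpow_neg]; congr 1; ring)⟩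
      · refine ⟨k - 2 * j, Or.inr (inv_eq_of_mul_eq_one_right ?_)⟩
        rw [h.mul_zpow_mul, hj, ← zpow_add, ← zpow_zero y]
        congr 1
        ring
  · rintro ⟨k, rfl | rfl⟩
    · exact hy k
    · exact mul_mem hx (hy k)

theorem notMem_closure (h : IsQuaternionPair x y) : y ∉ Subgroup.closure {x, y ^ 2} := by
  rw [h.mem_closure_iff]
  rintro ⟨k, hk | hk⟩
  · exact h.zpow_ne_zpow (a := 1) (b := 2 * k) (by omega) (by simpa using hk)
  · exact h.mul_zpow_ne_zpow (2 * k) 1 (by simpa using hk.symm)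

theorem mul_notMem_closure (h : IsQuaternionPair x y) :
    x * y ∉ Subgroup.closure {x, y ^ 2} := fun hxy =>
  h.notMem_closure ((Subgroup.mul_mem_cancel_left _ (Subgroup.subset_closure (by simp))).1 hxy)

theorem index_closure (h : IsQuaternionPair x y) :
    (Subgroup.closure {x, y ^ 2}).index = 2 := by
  refine Subgroup.index_eq_two_iff_exists_notMem_and.2 ⟨y, h.notMem_closure, fun b => ?_⟩
  simp only [h.mem_closure_iff]
  obtain ⟨k, rfl | rfl⟩ := h.exists_zpow b <;> obtain ⟨l, rfl | rfl⟩ := Int.even_or_odd' k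
  · exact Or.inr ⟨l, Or.inl rfl⟩
  · exact Or.inl ⟨l + 1, Or.inl (by rw [← zpow_add_one]; congr 1; ring)⟩
  · exact Or.inr ⟨l, Or.inr rfl⟩
  · exact Or.inl ⟨l + 1, Or.inr (by rw [mul_assoc, ← zpow_add_one]; congr 2; ring)⟩

theorem index_closure_singleton (h : IsQuaternionPair x y) :
    (Subgroup.closure {y}).index = 2 := by
  rw [← Subgroup.zpowers_eq_closure]
  refine Subgroup.index_eq_two_iff_exists_notMem_and'.2 ⟨x, h.notMem, fun b => ?_⟩
  obtain ⟨j, hj⟩ := h.sq_eq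
  obtain ⟨k, rfl | rfl⟩ := h.exists_zpow b
  · exact Or.inr ⟨k, rfl⟩
  · exact Or.inl ⟨4 * j + k, by simp only [zpow_add, ← hj, sq, mul_assoc]⟩

theorem closure_mul_mul (x y : G) :
    Subgroup.closure {x * y * y, y ^ 2} = Subgroup.closure {x, y ^ 2} := by
  have hy (z : G) : y ^ 2 ∈ Subgroup.closure {z, y ^ 2} := Subgroup.subset_closure (by simp)
  have hz (z : G) : z ∈ Subgroup.closure {z, y ^ 2} := Subgroup.subset_closure (by simp)
  rw [mul_assoc, ← sq]
  apply le_antisymm <;> rw [Subgroup.closure_le, Set.insert_subset_iff, Set.singleton_subset_iff]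
  · exact ⟨mul_mem (hz x) (hy x), hy x⟩
  · exact ⟨(Subgroup.mul_mem_cancel_right _ (hy _)).1 (hz _), hy _⟩

theorem commutator_closure_le (h : IsQuaternionPair x y) :
    ⁅Subgroup.closure {x, y ^ 2}, Subgroup.closure {x, y ^ 2}⁆ ≤ Subgroup.zpowers (y ^ 4) := by
  have hinv (k : ℤ) : (x * y ^ k)⁻¹ = y ^ (-k) * x⁻¹ := by rw [mul_inv_rev, zpow_neg]
  have hconj (k : ℤ) : x * y ^ k * x⁻¹ = y ^ (-k) := by
    rw [mul_inv_eq_iff_eq_mul, h.zpow_mul, neg_neg]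
  have hmem {k : ℤ} {g : G} (l : ℤ) (hg : g = y ^ k) (hk : k = 4 * l) :
      g ∈ Subgroup.zpowers (y ^ 4) :=
    ⟨l, by rw [hg, hk, _root_.zpow_mul]; norm_cast⟩
  rw [Subgroup.commutator_le]
  intro a ha b hb
  rw [h.mem_closure_iff] at ha hb
  obtain ⟨k, rfl | rfl⟩ := ha <;> obtain ⟨l, rfl | rfl⟩ := hb <;> rw [commutatorElement_def]
  · exact hmem 0 (k := 0) (by group) (by ring)
  · refine hmem k (k := 2 * k + 2 * k) ?_ (by ring)
    rw [hinv, ← mul_assoc (y ^ (2 * k)), h.zpow_mul]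
    calc _ = x * y ^ (-(2 * k) + 2 * l - 2 * k - 2 * l) * x⁻¹ := by group
      _ = _ := by rw [hconj]; congr 1; ring
  · refine hmem (-l) (k := -(2 * l) - 2 * l) ?_ (by ring)
    rw [hinv]
    calc _ = (x * y ^ (2 * l) * x⁻¹) * y ^ (-(2 * l)) := by group
      _ = _ := by rw [hconj, ← zpow_add]; congr 1
  · refine hmem (l - k) (k := (2 * l - 2 * k) + (2 * l - 2 * k)) ?_ (by ring)
    rw [h.mul_zpow_mul, mul_assoc, ← mul_inv_rev, h.mul_zpow_mul, mul_inv_rev, ← zpow_neg]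
    obtain ⟨j, hj⟩ := h.sq_eq
    rw [hj]
    simp only [← zpow_neg, ← zpow_add]
    congr 1
    ring

open scoped commutatorElement in
theorem of_zpow_four_mul (h : IsQuaternionPair x y) (k : ℤ)
    (hk : y ^ (4 * k) ∈ Subgroup.closure {x, y ^ 2}) :
    (Abelianization.of ⟨y ^ (4 * k), hk⟩ : Abelianization ↥(Subgroup.closure {x, y ^ 2})) = 1 := by
  have hx : x ∈ Subgroup.closure {x, y ^ 2} := Subgroup.subset_closure (by simp)
  have hy : y ^ (2 * -k) ∈ Subgroup.closure {x, y ^ 2} := h.mem_closure_iff.2 ⟨-k, Or.inl rfl⟩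
  have : (⟨y ^ (4 * k), hk⟩ : ↥(Subgroup.closure {x, y ^ 2})) =
      ⁅(⟨x, hx⟩ : ↥(Subgroup.closure {x, y ^ 2})), ⟨y ^ (2 * -k), hy⟩⁆ := by
    ext
    rw [commutatorElement_def]
    simp only [Subgroup.coe_mul, Subgroup.coe_inv]
    have : x * y ^ (2 * -k) = y ^ (2 * k) * x := by rw [h.zpow_mul]; congr 2; ring
    rw [this, mul_inv_cancel_right, ← zpow_neg, ← zpow_add]
    congr 1
    ring
  rw [this, map_commutatorElement, commutatorElement_eq_one_iff_mul_comm, mul_comm]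

theorem of_sq_ne_one (h : IsQuaternionPair x y) (hy : y ^ 2 ∈ Subgroup.closure {x, y ^ 2}) :
    (Abelianization.of ⟨y ^ 2, hy⟩ : Abelianization ↥(Subgroup.closure {x, y ^ 2})) ≠ 1 := by
  intro hone
  rw [← MonoidHom.mem_ker, Abelianization.ker_of] at hone
  have := Subgroup.mem_map_of_mem (Subgroup.closure {x, y ^ 2}).subtype hone
  rw [Subgroup.map_subtype_commutator] at this
  obtain ⟨k, hk⟩ := h.commutator_closure_le this
  refine h.zpow_ne_zpow (a := 4 * k) (b := 2) (by omega) ?_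
  rw [_root_.zpow_mul]
  exact_mod_cast hk

theorem ker_transfer_closure [Finite G] (h : IsQuaternionPair x y) :
    (MonoidHom.transfer (Abelianization.of : ↥(Subgroup.closure {x, y ^ 2}) →*
      Abelianization ↥(Subgroup.closure {x, y ^ 2}))).ker = Subgroup.closure {x * y, y ^ 2} := by
  have hV {g : G} (hg : g ∉ Subgroup.closure {x, y ^ 2}) :=
    MonoidHom.transfer_eq_sq_of_index_two h.index_closure Abelianization.of hg
  have hcoatom := Subgroup.isCoatom_of_index_eq_two h.mul_right.index_closure
  refine (hcoatom.le_iff_eq ?_).1 ?_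
  · intro htop
    have hy : y ∈ (⊤ : Subgroup G) := trivial
    rw [← htop, MonoidHom.mem_ker, hV h.notMem_closure] at hy
    exact h.of_sq_ne_one _ hy
  · rw [Subgroup.closure_le, Set.insert_subset_iff, Set.singleton_subset_iff]
    constructor
    · obtain ⟨j, hj⟩ := h.sq_eq
      rw [SetLike.mem_coe, MonoidHom.mem_ker, hV h.mul_notMem_closure]
      simp only [h.mul_self_mul, hj]
      exact h.of_zpow_four_mul j _
    · rw [SetLike.mem_coe, MonoidHom.mem_ker, map_pow, hV h.notMem_closure, ← map_pow]
      convert h.of_zpow_four_mul 1 (h.mem_closure_iff.2 ⟨2, Or.inl (by norm_num)⟩) using 2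
      ext
      simp only [Subgroup.coe_pow, ← pow_mul]
      norm_cast

theorem ker_transfer_closure_singleton [Finite G] (h : IsQuaternionPair x y) :
    (MonoidHom.transfer (Abelianization.of :
      ↥(Subgroup.closure {y}) →* Abelianization ↥(Subgroup.closure {y}))).ker =
      Subgroup.closure {y} := by
  have hV {g : G} (hg : g ∉ Subgroup.zpowers y) :=
    MonoidHom.transfer_eq_sq_of_index_two h.index_closure_singleton Abelianization.of
      (Subgroup.zpowers_eq_closure y ▸ hg)
  have hcoatom := Subgroup.isCoatom_of_index_eq_two h.index_closure_singleton
  refine (hcoatom.le_iff_eq ?_).1 ?_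
  · intro htop
    have hx : x ∈ (⊤ : Subgroup G) := trivial
    rw [← htop, MonoidHom.mem_ker, hV h.notMem, ← MonoidHom.mem_ker, Abelianization.ker_of] at hx
    have := Subgroup.mem_map_of_mem (Subgroup.closure {y}).subtype hx
    have hbot : ⁅Subgroup.closure {y}, Subgroup.closure {y}⁆ = ⊥ := by
      rw [← Subgroup.zpowers_eq_closure]
      exact Subgroup.commutator_eq_bot_iff_le_centralizer.2 (Subgroup.le_centralizer _)
    rw [Subgroup.map_subtype_commutator, hbot] at this
    exact h.sq_ne_one this
  · rw [Subgroup.closure_le, Set.singleton_subset_iff, SetLike.mem_coe, MonoidHom.mem_ker]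
    have heq := hV h.mul_right.notMem
    simp only [h.mul_self_mul] at heq
    rw [← hV h.notMem, map_mul] at heq
    exact mul_eq_left.1 heq

theorem isCoatom_iff [Finite G] (h : IsQuaternionPair x y) {m : ℕ} (hG : Nat.card G = 2 ^ m)
    (M : Subgroup G) :
    IsCoatom M ↔ M = Subgroup.closure {y} ∨ M = Subgroup.closure {x, y ^ 2} ∨
      M = Subgroup.closure {x * y, y ^ 2} := by
  have h₁ := Subgroup.isCoatom_of_index_eq_two h.index_closure_singleton
  have h₂ := Subgroup.isCoatom_of_index_eq_two h.index_closure
  have h₃ := Subgroup.isCoatom_of_index_eq_two h.mul_right.index_closure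
  constructor
  · intro hM
    have hindex := Subgroup.index_eq_two_of_isCoatom hG hM
    have hsq := Subgroup.sq_mem_of_index_two hindex y
    by_cases hy : y ∈ M
    · exact Or.inl ((h₁.le_iff_eq hM.1).1 (by simpa [Subgroup.closure_le] using hy))
    by_cases hx : x ∈ M
    · refine Or.inr (Or.inl ((h₂.le_iff_eq hM.1).1 ?_))
      simp [Subgroup.closure_le, Set.insert_subset_iff, hx, hsq]
    · refine Or.inr (Or.inr ((h₃.le_iff_eq hM.1).1 ?_))
      simp [Subgroup.closure_le, Set.insert_subset_iff, hsq,
        Subgroup.mul_mem_iff_of_index_two hindex, hx, hy]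
  · rintro (rfl | rfl | rfl) <;> assumption

/-- The commutator subgroup lies in every subgroup of index two, and it is strictly smaller because
there are several of them. -/
theorem commutator_lt (h : IsQuaternionPair x y) {M : Subgroup G} (hM : M.index = 2) :
    commutator G < M := by
  have hle {K : Subgroup G} (hK : K.index = 2) : commutator G ≤ K := by
    rw [commutator_def, Subgroup.commutator_le]
    intro a _ b _
    simp only [commutatorElement_def, Subgroup.mul_mem_iff_of_index_two hK, inv_mem_iff]
    tauto
  refine lt_of_le_of_ne (hle hM) ?_
  rintro rfl
  have hcoatom := Subgroup.isCoatom_of_index_eq_two hM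
  have h₂ := (hcoatom.le_iff_eq (Subgroup.isCoatom_of_index_eq_two h.index_closure).1).1
    (hle h.index_closure)
  have h₃ := (hcoatom.le_iff_eq (Subgroup.isCoatom_of_index_eq_two h.mul_right.index_closure).1).1
    (hle h.mul_right.index_closure)
  apply h.mul_notMem_closure
  rw [h₂, ← h₃]
  exact Subgroup.subset_closure (by simp)

theorem of_card [Finite G] {m : ℕ} (hm : 4 ≤ m) (hcard : Nat.card G = 2 ^ m)
    (hgen : Subgroup.closure {x, y} = ⊤) (hy : y ^ 2 ^ (m - 1) = 1)
    (hx : x ^ 2 = y ^ 2 ^ (m - 2)) (hconj : x⁻¹ * y * x = y⁻¹) : IsQuaternionPair x y := by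
  have hcomm : y * x = x * y⁻¹ := by rw [← hconj]; group
  have hx' : x ^ 2 = y ^ ((2 ^ (m - 2) : ℕ) : ℤ) := by rw [zpow_natCast, hx]
  have hall (g : G) : ∃ k : ℤ, g = y ^ k ∨ g = x * y ^ k := by
    have hg : g ∈ Subgroup.closure {x, y} := hgen ▸ Subgroup.mem_top g
    induction hg using Subgroup.closure_induction_left with
    | one => exact ⟨0, Or.inl (by simp)⟩
    | mul_left a ha b _ hb =>
      obtain rfl | rfl := ha <;> obtain ⟨k, rfl | rfl⟩ := hb
      · exact ⟨k, Or.inr rfl⟩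
      · exact ⟨_, Or.inl (by rw [← mul_assoc, ← sq, hx', ← zpow_add])⟩
      · exact ⟨1 + k, Or.inl (zpow_one_add _ _).symm⟩
      · exact ⟨-1 + k, Or.inr (by rw [← mul_assoc, hcomm, zpow_add, mul_assoc, zpow_neg_one])⟩
    | inv_mul_cancel a ha b _ hb =>
      obtain rfl | rfl := ha <;> obtain ⟨k, rfl | rfl⟩ := hb
      · refine ⟨-((2 ^ (m - 2) : ℕ) : ℤ) + k, Or.inr ?_⟩
        rw [inv_mul_eq_iff_eq_mul, ← mul_assoc, ← sq, hx', ← zpow_add, add_neg_cancel_left]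
      · exact ⟨k, Or.inl (inv_mul_cancel_left _ _)⟩
      · exact ⟨-1 + k, Or.inl (by rw [zpow_add, zpow_neg_one])⟩
      · exact ⟨1 + k, Or.inr (by
          rw [inv_mul_eq_iff_eq_mul, ← mul_assoc, hcomm, mul_assoc, zpow_one_add,
            inv_mul_cancel_left])⟩
  have hdvd : (Subgroup.zpowers y).index ∣ 2 := by
    refine Subgroup.index_dvd_two_iff'.2 ⟨x, fun b => ?_⟩
    obtain ⟨k, rfl | rfl⟩ := hall b
    · exact Or.inr ⟨k, rfl⟩
    · exact Or.inl ⟨((2 ^ (m - 2) : ℕ) : ℤ) + k, by simp only [zpow_add, ← hx', sq, mul_assoc]⟩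
  have hmul := (Subgroup.zpowers y).card_mul_index
  rw [Nat.card_zpowers, hcard] at hmul
  have hindex : (Subgroup.zpowers y).index = 2 := by
    refine ((Nat.dvd_prime Nat.prime_two).1 hdvd).resolve_left fun hone => ?_
    rw [hone, mul_one] at hmul
    have := orderOf_dvd_of_pow_eq_one hy
    rw [hmul, Nat.pow_dvd_pow_iff_le_right (by omega)] at this
    omega
  have hord : orderOf y = 2 ^ (m - 1) := by
    rw [hindex, show m = m - 1 + 1 by omega, pow_succ] at hmul
    simpa using Nat.eq_of_mul_eq_mul_right two_pos hmul
  refine ⟨hcomm, ?_, ?_, ?_, ?_, hall⟩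
  · refine ⟨2 ^ (m - 4), ?_⟩
    rw [hx']
    congr 1
    obtain ⟨n, rfl⟩ := Nat.exists_eq_add_of_le hm
    simp [show 4 + n - 2 = n + 2 by omega, pow_succ]
    ring
  · rw [hx]
    intro h
    have := orderOf_dvd_of_pow_eq_one h
    rw [hord, Nat.pow_dvd_pow_iff_le_right (by omega)] at this
    omega
  · intro hmem
    have htop : Subgroup.zpowers y = ⊤ := by
      rw [eq_top_iff, ← hgen, Subgroup.closure_le, Set.insert_subset_iff, Set.singleton_subset_iff]
      exact ⟨hmem, Subgroup.mem_zpowers y⟩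
    simp [htop] at hindex
  · intro k hk
    rw [← orderOf_dvd_iff_zpow_eq_one, hord] at hk
    refine dvd_trans ?_ hk
    exact_mod_cast pow_dvd_pow 2 (show 2 ≤ m - 1 by omega)

end IsQuaternionPair

/-- Let `G = Q(2^m)` be the generalized quaternion group of order `2^m`, `m ≥ 4`,
with generators `x, y` satisfying `y^{2^{m-1}} = 1`, `x² = y^{2^{m-2}}`,
`x⁻¹yx = y⁻¹`. The three maximal subgroups are `M₁ = ⟨y⟩`, `M₂ = ⟨x,y²⟩`,
`M₃ = ⟨xy,y²⟩`, and the transfer kernels are `Ker(V₁) = M₁/[G,G]`,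
`Ker(V₂) = M₃/[G,G]`, `Ker(V₃) = M₂/[G,G]`. In particular, every transfer has a
nontrivial kernel and no transfer is trivial on all of `G/[G,G]`. -/
theorem quaternion_transfer_kernels (m : ℕ) (hm : 4 ≤ m)
    (G : Type*) [Group G] [Finite G] (hcard : Nat.card G = 2 ^ m)
    (x y : G) (hgen : Subgroup.closure {x, y} = ⊤)
    (hy : y ^ 2 ^ (m - 1) = 1) (hx : x ^ 2 = y ^ 2 ^ (m - 2))
    (hconj : x⁻¹ * y * x = y⁻¹) :
    (∀ M : Subgroup G, IsCoatom M ↔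
        (M = Subgroup.closure {y} ∨ M = Subgroup.closure {x, y ^ 2} ∨
          M = Subgroup.closure {x * y, y ^ 2})) ∧
    (MonoidHom.transfer (Abelianization.of :
        ↥(Subgroup.closure {y}) →* Abelianization ↥(Subgroup.closure {y}))).ker =
      Subgroup.closure {y} ∧
    (MonoidHom.transfer (Abelianization.of :
        ↥(Subgroup.closure {x, y ^ 2}) →* Abelianization ↥(Subgroup.closure {x, y ^ 2}))).ker =
      Subgroup.closure {x * y, y ^ 2} ∧
    (MonoidHom.transfer (Abelianization.of :
        ↥(Subgroup.closure {x * y, y ^ 2}) →*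
          Abelianization ↥(Subgroup.closure {x * y, y ^ 2}))).ker =
      Subgroup.closure {x, y ^ 2} ∧
    (∀ M : Subgroup G, IsCoatom M →
      commutator G < (MonoidHom.transfer
          (Abelianization.of : ↥M →* Abelianization ↥M)).ker ∧
      (MonoidHom.transfer (Abelianization.of : ↥M →* Abelianization ↥M)).ker ≠ ⊤) := by
  have h := IsQuaternionPair.of_card hm hcard hgen hy hx hconj
  have hker₃ := h.mul_right.ker_transfer_closure
  simp only [IsQuaternionPair.closure_mul_mul] at hker₃
  refine ⟨h.isCoatom_iff hcard, h.ker_transfer_closure_singleton, h.ker_transfer_closure, hker₃,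
    fun M hM => ?_⟩
  have hindex : (MonoidHom.transfer (Abelianization.of : ↥M →* Abelianization ↥M)).ker.index =
      2 := by
    obtain rfl | rfl | rfl := (h.isCoatom_iff hcard M).1 hM
    · rw [h.ker_transfer_closure_singleton, h.index_closure_singleton]
    · rw [h.ker_transfer_closure, h.mul_right.index_closure]
    · rw [hker₃, h.index_closure]
  exact ⟨h.commutator_lt hindex, (Subgroup.isCoatom_of_index_eq_two hindex).1⟩
end

section
/- Let G = S(2^m) be the semidihedral group of order 2^m with m ≥ 4, with generators x, y satisfying y^{2^{m-1}} = 1, x² = 1, x⁻¹yx = y^{2^{m-2}-1}. Then the transfer kernels to the three maximal subgroups M₁ = ⟨y⟩, M₂ = ⟨x, y²⟩, M₃ = ⟨xy, y²⟩ are Ker(V₁) = M₂/[G,G], Ker(V₂) = M₃/[G,G], Ker(V₃) = M₂/[G,G]. In particular, M₂/[G,G] occurs as a transfer kernel twice and M₁/[G,G] never occurs. -/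
namespace MonoidHom

open Subgroup in
/-- The transfer to a subgroup of index two squares every element outside the subgroup. -/
theorem transfer_apply_of_index_eq_two {G A : Type*} [Group G] [CommGroup A] {H : Subgroup G}
    [H.FiniteIndex] (hH : H.index = 2) (ϕ : H →* A) {g : G} (hg : g ∉ H) :
    transfer ϕ g = ϕ ⟨g ^ 2, sq_mem_of_index_two hH g⟩ := by
  classical
  have hmem {a b : G} : a * b ∈ H ↔ (a ∈ H ↔ b ∈ H) := mul_mem_iff_of_index_two hH
  let := H.fintypeQuotientOfFiniteIndex
  have hper (q : G ⧸ H) : Function.minimalPeriod (g • ·) q = 2 := by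
    obtain ⟨a, rfl⟩ := QuotientGroup.mk_surjective q
    refine Function.minimalPeriod_eq_prime ?_ ?_
    · simp only [Function.IsPeriodicPt, Function.IsFixedPt, Function.iterate_succ,
        Function.iterate_zero, Function.comp, MulAction.Quotient.smul_mk, smul_eq_mul, id_eq]
      rw [QuotientGroup.eq]
      simp only [hmem, inv_mem_iff]
      tauto
    · simp only [Function.IsFixedPt, MulAction.Quotient.smul_mk, smul_eq_mul]
      rw [QuotientGroup.eq]
      simp only [hmem, inv_mem_iff]
      tauto
  have hsub (p q : Quotient (MulAction.orbitRel (zpowers g) (G ⧸ H))) : p = q := by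
    induction p using Quotient.inductionOn with | _ p
    induction q using Quotient.inductionOn with | _ q
    obtain ⟨a, rfl⟩ := QuotientGroup.mk_surjective p
    obtain ⟨b, rfl⟩ := QuotientGroup.mk_surjective q
    refine Quotient.sound (MulAction.orbitRel_apply.2 ?_)
    by_cases hab : a⁻¹ * b ∈ H
    · rw [(QuotientGroup.eq).2 hab]
      exact MulAction.mem_orbit_self _
    · refine ⟨⟨g, mem_zpowers g⟩, ?_⟩
      change ((g * b : G) : G ⧸ H) = a
      rw [QuotientGroup.eq]
      simp only [hmem, inv_mem_iff] at hab ⊢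
      tauto
  rw [transfer_eq_prod_quotient_orbitRel_zpowers_quot,
    Fintype.prod_eq_single (Quotient.mk _ ((1 : G) : G ⧸ H)) fun q hq => (hq (hsub _ _)).elim]
  generalize (Quotient.mk (MulAction.orbitRel (zpowers g) (G ⧸ H)) ((1 : G) : G ⧸ H)).out = q
  have hq (n : ℕ) (hn : n = 2) (a : G) (h : a⁻¹ * g ^ n * a ∈ H) :
      ϕ ⟨a⁻¹ * g ^ n * a, h⟩ = ϕ ⟨g ^ 2, sq_mem_of_index_two hH g⟩ := by
    subst hn
    have key (c : H) (d : H) (e : H) (he : (e : G) = (c : G)⁻¹ * d * c) : ϕ e = ϕ d := by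
      have : e = c⁻¹ * d * c := Subtype.ext he
      rw [this, map_mul, map_mul, map_inv, mul_right_comm, inv_mul_cancel, one_mul]
    by_cases ha : a ∈ H
    · exact key ⟨a, ha⟩ _ _ rfl
    · exact key ⟨g⁻¹ * a, by simp only [hmem, inv_mem_iff]; tauto⟩ _ _ (by simp; group)
  exact hq _ (hper q) _ _

/-- A subgroup of index two contained in a proper kernel is equal to that kernel. -/
theorem ker_eq_of_index_eq_two {G A : Type*} [Group G] [Group A] {H : Subgroup G}
    (hH : H.index = 2) {f : G →* A} (hf : H ≤ f.ker) {a : G} (ha : f a ≠ 1) : f.ker = H := by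
  refine le_antisymm (fun g hg => ?_) hf
  by_contra hgH
  have haH : a ∉ H := fun h => ha (hf h)
  have h : f (g * a) = 1 := hf ((Subgroup.mul_mem_iff_of_index_two hH).2 (by tauto))
  rw [map_mul, MonoidHom.mem_ker.1 hg, one_mul] at h
  exact ha h

end MonoidHom

namespace Subgroup

open scoped commutatorElement

variable {G : Type*} [Group G]

/-- If two elements commute modulo a normal subgroup, so do all elements they generate. -/
theorem commutatorElement_mem_of_mem_closure_pair {K : Subgroup G} [K.Normal] {a b : G}
    (hab : ⁅a, b⁆ ∈ K) {g h : G} (hg : g ∈ closure {a, b}) (hh : h ∈ closure {a, b}) :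
    ⁅g, h⁆ ∈ K := by
  have key (u v : G) : ⁅u, v⁆ ∈ K ↔ Commute (u : G ⧸ K) (v : G ⧸ K) := by
    rw [← commutatorElement_eq_one_iff_commute, ← QuotientGroup.eq_one_iff]
    rfl
  rw [key] at hab ⊢
  induction hg, hh using closure_induction₂ with
  | mem u v hu hv =>
    rcases hu with rfl | rfl <;> rcases hv with rfl | rfl
    exacts [.refl _, hab, hab.symm, .refl _]
  | one_left => exact Commute.one_left _
  | one_right => exact Commute.one_right _
  | mul_left _ _ _ _ _ _ h₁ h₂ => exact h₁.mul_left h₂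
  | mul_right _ _ _ _ _ _ h₁ h₂ => exact h₁.mul_right h₂
  | inv_left _ _ _ _ h => exact h.inv_left
  | inv_right _ _ _ _ h => exact h.inv_right

/-- A normal subgroup containing the commutator of two elements contains every element of the
derived subgroup of any subgroup of the group they generate. -/
theorem mem_of_abelianization_of_eq_one {H K : Subgroup G} [K.Normal] {a b : G}
    (hab : ⁅a, b⁆ ∈ K) (hH : H ≤ closure {a, b}) {g : G} {hg : g ∈ H}
    (h : Abelianization.of (⟨g, hg⟩ : H) = 1) : g ∈ K := by
  rw [← MonoidHom.mem_ker, Abelianization.ker_of] at h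
  have hle : ⁅(⊤ : Subgroup H), ⊤⁆ ≤ K.comap H.subtype := commutator_le.2 fun u _ v _ =>
    commutatorElement_mem_of_mem_closure_pair hab (hH u.2) (hH v.2)
  exact hle h

/-- A commutator of elements of a subgroup is trivial in the abelianization of the subgroup. -/
theorem abelianization_of_commutatorElement {H : Subgroup G} {a b : G} (ha : a ∈ H) (hb : b ∈ H)
    (h : ⁅a, b⁆ ∈ H) : Abelianization.of (⟨⁅a, b⁆, h⟩ : H) = 1 := by
  have : (⟨⁅a, b⁆, h⟩ : H) = ⁅(⟨a, ha⟩ : H), ⟨b, hb⟩⁆ := rfl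
  rw [this, map_commutatorElement, commutatorElement_eq_one_iff_mul_comm, mul_comm]

/-- A group generated by a normal subgroup and an element whose square lies in it is the union of
two cosets. -/
theorem mem_or_mul_mem_of_mem_closure {N : Subgroup G} [N.Normal] {a : G} (ha : a ^ 2 ∈ N)
    {S : Set G} (hS : ∀ s ∈ S, s ∈ N ∨ s * a ∈ N) {g : G} (hg : g ∈ closure S) :
    g ∈ N ∨ g * a ∈ N := by
  have hone (u : G) : u ∈ N ↔ (u : G ⧸ N) = 1 := (QuotientGroup.eq_one_iff u).symm
  simp only [hone, QuotientGroup.mk_mul, QuotientGroup.mk_pow] at ha hS ⊢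
  have ha' : (a : G ⧸ N)⁻¹ = a := by
    rw [inv_eq_iff_mul_eq_one, ← pow_two, ha]
  simp only [mul_eq_one_iff_eq_inv, ha'] at hS ⊢
  induction hg using closure_induction with
  | mem s hs => exact hS s hs
  | one => exact .inl rfl
  | mul u v _ _ hu hv =>
    rw [QuotientGroup.mk_mul]
    rcases hu with hu | hu <;> rcases hv with hv | hv <;> simp [hu, hv, ← pow_two, ha]
  | inv u _ hu =>
    rw [QuotientGroup.mk_inv]
    rcases hu with hu | hu <;> simp [hu, ha']

/-- If an involution `x` conjugates `y` to a power of itself, then the powers of `y` generate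
normal subgroups of the group generated by `x` and `y`. -/
theorem normal_zpowers_pow {x y : G} (hgen : closure {x, y} = ⊤) (hx : x ^ 2 = 1) {e : ℕ}
    (hconj : x⁻¹ * y * x = y ^ e) (k : ℕ) : (zpowers (y ^ k)).Normal := by
  rw [← normalizer_eq_top_iff, eq_top_iff, ← hgen, closure_le]
  have hx' : x⁻¹ = x := by rw [inv_eq_iff_mul_eq_one, ← pow_two, hx]
  have hstep (n : G) (hn : n ∈ zpowers (y ^ k)) : x * n * x⁻¹ ∈ zpowers (y ^ k) := by
    obtain ⟨i, rfl⟩ := mem_zpowers_iff.1 hn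
    have hy : x * y * x⁻¹ = y ^ e := by rwa [hx'] at hconj ⊢
    rw [← conj_zpow, ← conj_pow, hy, ← pow_mul, mul_comm, pow_mul]
    exact zpow_mem (pow_mem (mem_zpowers _) _) _
  refine Set.insert_subset (mem_normalizer_iff.2 fun n => ⟨hstep n, fun hn => ?_⟩)
    (Set.singleton_subset_iff.2 (centralizer_le_normalizer _ (mem_centralizer_iff.2 ?_)))
  · have := hstep _ hn
    rw [hx'] at this
    rwa [show x * (x * n * x) * x = x ^ 2 * n * x ^ 2 by simp only [pow_two, mul_assoc], hx,
      one_mul, mul_one] at this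
  · intro n hn
    obtain ⟨i, rfl⟩ := mem_zpowers_iff.1 hn
    exact ((Commute.refl y).pow_right k).zpow_right i |>.symm

end Subgroup

/-- Let `G = S(2^m)` be the semidihedral group of order `2^m`, `m ≥ 4`, with
generators `x, y` satisfying `y^{2^{m-1}} = 1`, `x² = 1`, `x⁻¹yx = y^{2^{m-2}-1}`.
The transfer kernels to the maximal subgroups `M₁ = ⟨y⟩`, `M₂ = ⟨x,y²⟩`,
`M₃ = ⟨xy,y²⟩` are `Ker(V₁) = M₂/[G,G]`, `Ker(V₂) = M₃/[G,G]`,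
`Ker(V₃) = M₂/[G,G]`. In particular `M₂/[G,G]` occurs twice as a transfer kernel
and `M₁/[G,G]` never occurs. -/
theorem semidihedral_transfer_kernels (m : ℕ) (hm : 4 ≤ m)
    (G : Type*) [Group G] [Finite G] (hcard : Nat.card G = 2 ^ m)
    (x y : G) (hgen : Subgroup.closure {x, y} = ⊤)
    (hy : y ^ 2 ^ (m - 1) = 1) (hx : x ^ 2 = 1)
    (hconj : x⁻¹ * y * x = y ^ (2 ^ (m - 2) - 1)) :
    (MonoidHom.transfer (Abelianization.of :
        ↥(Subgroup.closure {y}) →* Abelianization ↥(Subgroup.closure {y}))).ker =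
      Subgroup.closure {x, y ^ 2} ∧
    (MonoidHom.transfer (Abelianization.of :
        ↥(Subgroup.closure {x, y ^ 2}) →* Abelianization ↥(Subgroup.closure {x, y ^ 2}))).ker =
      Subgroup.closure {x * y, y ^ 2} ∧
    (MonoidHom.transfer (Abelianization.of :
        ↥(Subgroup.closure {x * y, y ^ 2}) →*
          Abelianization ↥(Subgroup.closure {x * y, y ^ 2}))).ker =
      Subgroup.closure {x, y ^ 2} ∧
    Subgroup.closure ({x, y ^ 2} : Set G) ≠ Subgroup.closure ({y} : Set G) ∧
    Subgroup.closure ({x * y, y ^ 2} : Set G) ≠ Subgroup.closure ({y} : Set G) := by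
  open scoped commutatorElement in
  obtain ⟨k, rfl⟩ := Nat.exists_eq_add_of_le' hm
  have hx' : x⁻¹ = x := by rw [inv_eq_iff_mul_eq_one, ← pow_two, hx]
  have hz : x * y * x * y = (y ^ 4) ^ 2 ^ k := by
    rw [hx'] at hconj
    rw [hconj, ← pow_succ, ← pow_mul, show k + 4 - 2 = k + 2 by omega,
      Nat.sub_add_cancel Nat.one_le_two_pow]
    congr 1
    ring
  have hxx : x * x = 1 := by rw [← pow_two, hx]
  have hN (j : ℕ) : (Subgroup.zpowers (y ^ j)).Normal := Subgroup.normal_zpowers_pow hgen hx hconj j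
  have hN1 : (Subgroup.zpowers y).Normal := by simpa using hN 1
  have hN2 := hN 2
  have hN4 := hN 4
  have h42 : y ^ 4 = (y ^ 2) ^ 2 := by rw [← pow_mul]
  have hy1 : y ∈ Subgroup.zpowers y := Subgroup.mem_zpowers y
  have hy2 : y ^ 2 ∈ Subgroup.zpowers (y ^ 2) := Subgroup.mem_zpowers _
  have hz4 : x * y * x * y ∈ Subgroup.zpowers (y ^ 4) :=
    hz ▸ pow_mem (Subgroup.mem_zpowers _) _
  have h4le : Subgroup.zpowers (y ^ 4) ≤ Subgroup.zpowers (y ^ 2) := by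
    rw [Subgroup.zpowers_le, h42]
    exact pow_mem hy2 _
  have h2le : Subgroup.zpowers (y ^ 2) ≤ Subgroup.zpowers y := by
    rw [Subgroup.zpowers_le]
    exact pow_mem hy1 _
  have hxy2 : (x * y) ^ 2 = x * y * x * y := by simp only [pow_two, mul_assoc]
  have hzz : (x * y * x * y) ^ 2 = 1 := by
    rw [hz, ← pow_mul, ← pow_mul, ← hy]
    congr 1
    rw [show k + 4 - 1 = k + 3 by omega]
    ring
  have hyz : Commute y (x * y * x * y) := by
    rw [hz]
    exact ((Commute.refl y).pow_right 4).pow_right _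
  have hxyx : x * y * x = (x * y * x * y) * y⁻¹ := by group
  have hxy2x : x * y ^ 2 * x = y⁻¹ ^ 2 := by
    have h : x * y ^ 2 * x = (x * y * x) ^ 2 := by
      simp only [pow_two, mul_assoc]
      rw [← mul_assoc x x, hxx, one_mul]
    rw [h, hxyx, (hyz.symm.inv_right).mul_pow, hzz, one_mul]
  have hcomm : ⁅x, y ^ 2⁆ = (y ^ 4)⁻¹ := by
    rw [commutatorElement_def, hx', hxy2x]
    group
  have hcomm' : ⁅x * y, y ^ 2⁆ = (y ^ 4)⁻¹ := by
    rw [← hcomm, commutatorElement_def, commutatorElement_def]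
    group
  have hcommxy : ⁅x, y⁆ ∈ Subgroup.zpowers (y ^ 2) := by
    rw [commutatorElement_def, hx', hxyx, mul_assoc, ← mul_inv_rev, ← pow_two]
    exact mul_mem (h4le hz4) (inv_mem hy2)
  have hxnot : x ∉ Subgroup.zpowers y := by
    intro h
    have htop : Subgroup.zpowers y = ⊤ := by
      rw [eq_top_iff, ← hgen, Subgroup.closure_le]
      exact Set.insert_subset h (Set.singleton_subset_iff.2 hy1)
    have hc : orderOf y = 2 ^ (k + 4) := by
      rw [← hcard, ← Nat.card_zpowers, htop, Subgroup.card_top]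
    have hle := Nat.le_of_dvd (by positivity) (orderOf_dvd_of_pow_eq_one hy)
    rw [hc] at hle
    exact absurd hle (not_le.2 (Nat.pow_lt_pow_right (by norm_num) (by omega)))
  have hindex (M : Subgroup G) (hM : Subgroup.zpowers (y ^ 2) ≤ M) (a : G) (ha : a ∉ M)
      (ha2 : a ^ 2 ∈ Subgroup.zpowers (y ^ 2)) (hxM : x ∈ M ∨ x * a ∈ M)
      (hyM : y ∈ M ∨ y * a ∈ M) : M.index = 2 := by
    have hnormal : M.Normal := ⟨fun n hn g => by
      have h : ⁅g, n⁆ ∈ Subgroup.zpowers (y ^ 2) :=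
        Subgroup.commutatorElement_mem_of_mem_closure_pair hcommxy
          (hgen ▸ Subgroup.mem_top g) (hgen ▸ Subgroup.mem_top n)
      have := mul_mem (hM h) hn
      rwa [commutatorElement_def, inv_mul_cancel_right] at this⟩
    refine Subgroup.index_eq_two_iff_exists_notMem_and.2 ⟨a, ha, fun b => ?_⟩
    refine (Subgroup.mem_or_mul_mem_of_mem_closure (hM ha2) (S := {x, y}) ?_
      (hgen ▸ Subgroup.mem_top b)).symm
    rintro s (rfl | rfl)
    exacts [hxM, hyM]
  have hord : orderOf y = 2 ^ (k + 3) := by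
    have h := (Subgroup.zpowers y).card_mul_index
    rw [hindex _ h2le x hxnot (by rw [hx]; exact one_mem _) (.inr (by rw [hxx]; exact one_mem _))
      (.inl hy1), Nat.card_zpowers, hcard, show 2 ^ (k + 4) = 2 ^ (k + 3) * 2 by ring] at h
    exact Nat.eq_of_mul_eq_mul_right two_pos h
  have hdvd (i : ℤ) (h : y ^ i = 1) : (8 : ℤ) ∣ i := by
    have h' := orderOf_dvd_iff_zpow_eq_one.2 h
    rw [hord] at h'
    refine dvd_trans ⟨2 ^ k, ?_⟩ h'
    push_cast
    ring
  have hynot : y ∉ Subgroup.zpowers (y ^ 2) := by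
    intro h
    obtain ⟨i, hi⟩ := Subgroup.mem_zpowers_iff.1 h
    have := hdvd (2 * i - 1) (by
      rw [zpow_sub, zpow_mul, zpow_one, mul_inv_eq_one]
      exact_mod_cast hi)
    omega
  have hy2not : y ^ 2 ∉ Subgroup.zpowers (y ^ 4) := by
    intro h
    obtain ⟨i, hi⟩ := Subgroup.mem_zpowers_iff.1 h
    have := hdvd (4 * i - 2) (by
      rw [zpow_sub, zpow_mul, mul_inv_eq_one]
      exact_mod_cast hi)
    omega
  have hM1 : Subgroup.closure {y} = Subgroup.zpowers y := (Subgroup.zpowers_eq_closure y).symm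
  set M₁ := Subgroup.closure {y}
  set M₂ := Subgroup.closure {x, y ^ 2}
  set M₃ := Subgroup.closure {x * y, y ^ 2}
  have hx2 : x ∈ M₂ := Subgroup.subset_closure (by simp)
  have hyy2 : y ^ 2 ∈ M₂ := Subgroup.subset_closure (by simp)
  have hxy3 : x * y ∈ M₃ := Subgroup.subset_closure (by simp)
  have hyy3 : y ^ 2 ∈ M₃ := Subgroup.subset_closure (by simp)
  have hyM2 : y ∉ M₂ := by
    intro h
    rcases Subgroup.mem_or_mul_mem_of_mem_closure (N := Subgroup.zpowers (y ^ 2)) (a := x)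
      (by rw [hx]; exact one_mem _) (by
        rintro s (rfl | rfl)
        exacts [.inr (by rw [hxx]; exact one_mem _), .inl hy2]) h with h | h
    · exact hynot h
    · exact hxnot ((Subgroup.mul_mem_cancel_left _ hy1).1 (h2le h))
  have hyM3 : y ∉ M₃ := by
    intro h
    have hxyN : (x * y) ^ 2 ∈ Subgroup.zpowers (y ^ 2) := hxy2 ▸ h4le hz4
    rcases Subgroup.mem_or_mul_mem_of_mem_closure hxyN (by
        rintro s (rfl | rfl)
        exacts [.inr (by rwa [← pow_two]), .inl hy2]) h with h | h
    · exact hynot h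
    · exact hxnot ((Subgroup.mul_mem_cancel_right _ hy1).1
        ((Subgroup.mul_mem_cancel_left _ hy1).1 (h2le h)))
  have hxM3 : x ∉ M₃ := fun h => hyM3 ((Subgroup.mul_mem_cancel_left _ h).1 hxy3)
  have hxyM2 : x * y ∉ M₂ := fun h => hyM2 ((Subgroup.mul_mem_cancel_left _ hx2).1 h)
  have hxM1 : x ∉ M₁ := hM1 ▸ hxnot
  have hyM1 : y ∈ M₁ := hM1 ▸ hy1
  have hxyM1 : x * y ∉ M₁ := fun h => hxM1 ((Subgroup.mul_mem_cancel_right _ hyM1).1 h)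
  have hi1 : M₁.index = 2 := hindex _ (hM1 ▸ h2le) x hxM1 (by rw [hx]; exact one_mem _)
    (.inr (by rw [hxx]; exact one_mem _)) (.inl hyM1)
  have hi2 : M₂.index = 2 := hindex _ (Subgroup.zpowers_le.2 hyy2) y hyM2 hy2 (.inl hx2)
    (.inr (by rwa [← pow_two]))
  have hi3 : M₃.index = 2 := hindex _ (Subgroup.zpowers_le.2 hyy3) y hyM3 hy2 (.inr hxy3)
    (.inr (by rwa [← pow_two]))
  have hof4 (M : Subgroup G) (a : G) (ha : a ∈ M) (hb : y ^ 2 ∈ M)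
      (hab : ⁅a, y ^ 2⁆ = (y ^ 4)⁻¹) (h : y ^ 4 ∈ M) :
      Abelianization.of (⟨y ^ 4, h⟩ : M) = 1 := by
    have := Subgroup.abelianization_of_commutatorElement ha hb (hab ▸ inv_mem h)
    rw [← inv_eq_one, ← map_inv, ← this]
    exact congrArg _ (Subtype.ext hab.symm)
  have hker_le {A : Type _} [Group A] (f : G →* A) (a : G) (ha : f a = 1) (hb : f (y ^ 2) = 1) :
      Subgroup.closure {a, y ^ 2} ≤ f.ker :=
    (Subgroup.closure_le _).2 (Set.insert_subset ha (Set.singleton_subset_iff.2 hb))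
  refine ⟨?_, ?_, ?_, fun h => hxM1 (h ▸ hx2), fun h => hxyM1 (h ▸ hxy3)⟩
  · set V := MonoidHom.transfer (Abelianization.of : M₁ →* Abelianization M₁)
    have hVx : V x = 1 := by
      rw [MonoidHom.transfer_apply_of_index_eq_two hi1 _ hxM1, ← map_one Abelianization.of]
      exact congrArg _ (Subtype.ext hx)
    have hVy : V y = Abelianization.of ⟨(x * y) ^ 2, Subgroup.sq_mem_of_index_two hi1 _⟩ := by
      rw [← MonoidHom.transfer_apply_of_index_eq_two hi1 _ hxyM1]
      change V y = V (x * y)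
      rw [map_mul, hVx, one_mul]
    have hne : x * y * x * y ≠ 1 := by
      intro h
      rw [hz, ← pow_mul, orderOf_dvd_iff_pow_eq_one.symm, hord,
        show 4 * 2 ^ k = 2 ^ (k + 2) by ring, Nat.pow_dvd_pow_iff_le_right (by norm_num)] at h
      omega
    refine MonoidHom.ker_eq_of_index_eq_two hi2 (hker_le V x hVx ?_) (a := y) ?_
    · rw [map_pow, hVy, ← map_pow, ← map_one Abelianization.of]
      exact congrArg _ (Subtype.ext (by simp [hxy2, hzz]))
    · rw [hVy]
      intro h
      have := Subgroup.mem_of_abelianization_of_eq_one (K := ⊥) (a := y) (b := y)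
        (by simp) (by rw [Set.pair_eq_singleton]) h
      exact hne (hxy2 ▸ Subgroup.mem_bot.1 this)
  · set V := MonoidHom.transfer (Abelianization.of : M₂ →* Abelianization M₂)
    have hVy : V y = Abelianization.of ⟨y ^ 2, Subgroup.sq_mem_of_index_two hi2 _⟩ :=
      MonoidHom.transfer_apply_of_index_eq_two hi2 _ hyM2
    have hof := hof4 M₂ x hx2 hyy2 hcomm (h42 ▸ pow_mem hyy2 2)
    refine MonoidHom.ker_eq_of_index_eq_two hi3 (hker_le V (x * y) ?_ ?_) (a := y) ?_
    · rw [MonoidHom.transfer_apply_of_index_eq_two hi2 _ hxyM2, ← one_pow (2 ^ k), ← hof, ← map_pow]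
      exact congrArg _ (Subtype.ext (hxy2.trans hz))
    · rw [map_pow, hVy, ← hof, ← map_pow]
      exact congrArg _ (Subtype.ext h42.symm)
    · rw [hVy]
      exact fun h => hy2not (Subgroup.mem_of_abelianization_of_eq_one
        (hcomm ▸ inv_mem (Subgroup.mem_zpowers _)) le_rfl h)
  · set V := MonoidHom.transfer (Abelianization.of : M₃ →* Abelianization M₃)
    have hVy : V y = Abelianization.of ⟨y ^ 2, Subgroup.sq_mem_of_index_two hi3 _⟩ :=
      MonoidHom.transfer_apply_of_index_eq_two hi3 _ hyM3
    have hof := hof4 M₃ (x * y) hxy3 hyy3 hcomm' (h42 ▸ pow_mem hyy3 2)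
    refine MonoidHom.ker_eq_of_index_eq_two hi2 (hker_le V x ?_ ?_) (a := y) ?_
    · rw [MonoidHom.transfer_apply_of_index_eq_two hi3 _ hxM3, ← map_one Abelianization.of]
      exact congrArg _ (Subtype.ext hx)
    · rw [map_pow, hVy, ← hof, ← map_pow]
      exact congrArg _ (Subtype.ext h42.symm)
    · rw [hVy]
      exact fun h => hy2not (Subgroup.mem_of_abelianization_of_eq_one
        (hcomm' ▸ inv_mem (Subgroup.mem_zpowers _)) le_rfl h)
end
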